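/- arXiv:1501.01810 — 5 statements merged into one kernel-verified Lean document; each statement's English description precedes it below -/
import Mathlib

section
/- Let g ≥ 3. The matrices T_1, …, T_{g−1}, U_1, …, U_m and the B_j (for those indices j for which b_j is a generator) satisfy all the defining relations (A1)–(A9b), (B1)–(B2), (C1)–(C8) of the presented group G_{g,1} when each a_j is replaced by T_j, each u_j by U_j, and each b_j by B_j. Consequently there is a unique group homomorphism ψ : G_{g,1} → GL(g,ℤ) with ψ(a_j) = T_j for 1 ≤ j ≤ g−1, ψ(u_j) = U_j for 1 ≤ j ≤ m, and ψ(b_j) = B_j for every generator b_j. -/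
/-- `γ_1 + ⋯ + γ_g`, the all-ones vector in `ℤ^g`. -/
def onesVec (g : ℕ) : Fin g → ℤ := fun _ => 1

/-- The matrix `T_j` (index `j` is 1-based): the action of the Dehn twist `a_j`
on `H_1(N_{g,1};ℤ) ≅ ℤ^g`. -/
def Tmat (g j : ℕ) : Matrix (Fin g) (Fin g) ℤ :=
  Matrix.of fun k l =>
    if k.1 + 1 = j then (if l.1 + 1 = j + 1 then 1 else 0)
    else if k.1 + 1 = j + 1 then
      (if l.1 + 1 = j then -1 else if l.1 + 1 = j + 1 then 2 else 0)
    else if k = l then 1 else 0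

/-- The matrix `U_j` (index `j` is 1-based): the action of the crosscap transposition `u_j`. -/
def Umat (g j : ℕ) : Matrix (Fin g) (Fin g) ℤ :=
  Matrix.of fun k l =>
    if k.1 + 1 = j then (if l.1 + 1 = j + 1 then 1 else 0)
    else if k.1 + 1 = j + 1 then (if l.1 + 1 = j then 1 else 0)
    else if k = l then 1 else 0

/-- The matrix `B_j`: the action of the twist `b_j`;
`B_j γ_i = γ_i + (−1)^i (γ_1 + ⋯ + γ_{2j+2})` for (1-based) `i ≤ 2j+2`. -/
def Bmat (g j : ℕ) : Matrix (Fin g) (Fin g) ℤ :=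
  Matrix.of fun k l =>
    (if k = l then 1 else 0) +
      (if k.1 + 1 ≤ 2 * j + 2 ∧ l.1 + 1 ≤ 2 * j + 2 then (-1 : ℤ) ^ (l.1 + 1) else 0)

/-- The index set of the generators `b_j` in the Paris–Szepietowski presentation:
`b_1` is present when `g ≥ 4`, and `b_0, b_1, …, b_{(g-2)/2}` are present when `g ≥ 6` is even. -/
def bIdx (g j : ℕ) : Prop := (4 ≤ g ∧ j = 1) ∨ (Even g ∧ 6 ≤ g ∧ j ≤ (g - 2) / 2)

/-- The defining relations of the Paris–Szepietowski presentation of the mapping class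
group of `N_{g,1}`, stated for elements `a j`, `u j`, `b j` of a monoid.  Each relation is
imposed whenever all generators occurring in it are present (`a_j` for `1 ≤ j ≤ g-1`,
`u_j` for `1 ≤ j ≤ min 5 (g-1)`, `b_j` for `bIdx g j`). -/
structure SatG1 {H : Type*} [Monoid H] (g : ℕ) (a u b : ℕ → H) : Prop where
  A1 : ∀ j k, 1 ≤ j → j ≤ g - 1 → 1 ≤ k → k ≤ g - 1 → (1 : ℤ) < |(j : ℤ) - (k : ℤ)| →
    a j * a k = a k * a j
  A2 : ∀ j, 1 ≤ j → j ≤ g - 2 → a j * a (j+1) * a j = a (j+1) * a j * a (j+1)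
  A3 : ∀ j, 4 ≤ g → 1 ≤ j → j ≤ g - 1 → j ≠ 4 → a j * b 1 = b 1 * a j
  A4 : 5 ≤ g → b 1 * a 4 * b 1 = a 4 * b 1 * a 4
  A5 : 5 ≤ g → (a 2 * a 3 * a 4 * b 1) ^ 10 = (a 1 * a 2 * a 3 * a 4 * b 1) ^ 6
  A6 : 7 ≤ g → (a 2 * a 3 * a 4 * a 5 * a 6 * b 1) ^ 12
      = (a 1 * a 2 * a 3 * a 4 * a 5 * a 6 * b 1) ^ 9
  B1 : 4 ≤ g → u 1 * u 3 = u 3 * u 1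
  B2 : u 1 * u 2 * u 1 = u 2 * u 1 * u 2
  C1 : ∀ j, 3 ≤ j → j ≤ g - 1 → u 1 * a j = a j * u 1
  C2 : a 1 * u 2 * u 1 = u 2 * u 1 * a 2
  C4 : a 1 * u 1 * a 1 = u 1
  C5 : ∀ j, 1 ≤ j → j ≤ min 5 (g - 1) - 1 →
    u (j+1) * a j * a (j+1) * u j = a j * a (j+1)
  C6 : 4 ≤ g → (u 3 * b 1) ^ 2 = (a 1 * a 2 * a 3) ^ 2 * (u 1 * u 2 * u 3) ^ 2
  C7 : 6 ≤ g → u 5 * b 1 = b 1 * u 5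
  C8 : 5 ≤ g → b 1 * a 4 * u 4
      = a 4 * u 4 * (a 4 * a 3 * a 2 * a 1 * u 1 * u 2 * u 3 * u 4) * b 1
  A7 : Even g → 6 ≤ g → b 0 = a 1
  A8 : Even g → 6 ≤ g → ∀ j, 1 ≤ j → j ≤ (g - 4) / 2 →
    b (j+1) * (b (j-1) * a (2*j) * a (2*j+1) * a (2*j+2) * a (2*j+3)) ^ 6
      = (b (j-1) * a (2*j) * a (2*j+1) * a (2*j+2) * a (2*j+3) * b j) ^ 5
  A9a : g = 6 → b 2 * b 1 = b 1 * b 2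
  A9b : Even g → 8 ≤ g → b ((g-2)/2) * a (g-5) = a (g-5) * b ((g-2)/2)

/-- `(G, a, u, b)` is *the* Paris–Szepietowski presented group `G_{g,1}`:  the elements
`a j` (for `1 ≤ j ≤ g-1`), `u j` (for `1 ≤ j ≤ min 5 (g-1)`) and `b j` (for `bIdx g j`)
satisfy the defining relations, and `G` is universal with this property. -/
def IsPresentedG1 (g : ℕ) (G : Type) [Group G] (a u b : ℕ → G) : Prop :=
  SatG1 g a u b ∧
    ∀ (H : Type) [Group H], ∀ a' u' b' : ℕ → H, SatG1 g a' u' b' →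
      ∃! f : G →* H,
        (∀ j, 1 ≤ j → j ≤ g - 1 → f (a j) = a' j) ∧
        (∀ j, 1 ≤ j → j ≤ min 5 (g - 1) → f (u j) = u' j) ∧
        (∀ j, bIdx g j → f (b j) = b' j)

open Matrix Finset

/-- The matrix `1 + v wᵀ` of size `g`, for vectors given as restrictions of sequences. -/
def rankOneUpdate (g : ℕ) (v w : ℕ → ℤ) : Matrix (Fin g) (Fin g) ℤ :=
  1 + vecMulVec (fun k : Fin g => v k) (fun l : Fin g => w l)

/-- The pairing `w · v` of the first `g` entries of two sequences. -/
def pairing (g : ℕ) (w v : ℕ → ℤ) : ℤ := ∑ x ∈ range g, w x * v x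

/-- The sequence of coordinates of `γ_j + γ_{j+1}`. -/
def twistVec (j x : ℕ) : ℤ := if x + 1 = j ∨ x = j then 1 else 0

/-- The sequence of coordinates of the functional `γ_{j+1}^* - γ_j^*`. -/
def twistForm (j x : ℕ) : ℤ := if x + 1 = j then -1 else if x = j then 1 else 0

/-- The sequence of coordinates of `γ_1 + ⋯ + γ_{2j+2}`. -/
def sumVec (j x : ℕ) : ℤ := if x < 2 * j + 2 then 1 else 0

/-- The sequence of coordinates of the functional `γ_i ↦ (-1)^i` for `i ≤ 2j+2`. -/
def altForm (j x : ℕ) : ℤ := if x < 2 * j + 2 then (-1) ^ (x + 1) else 0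

theorem Tmat_eq_rankOneUpdate (g j : ℕ) :
    Tmat g j = rankOneUpdate g (twistVec j) (twistForm j) := by
  ext k l
  simp only [Tmat, rankOneUpdate, twistVec, twistForm, of_apply, Matrix.add_apply, one_apply,
    vecMulVec_apply, Fin.ext_iff]
  split_ifs <;> omega

theorem Umat_eq_rankOneUpdate (g j : ℕ) :
    Umat g j = rankOneUpdate g (-twistForm j) (twistForm j) := by
  ext k l
  simp only [Umat, rankOneUpdate, twistForm, of_apply, Matrix.add_apply, one_apply,
    vecMulVec_apply, Fin.ext_iff, Pi.neg_apply]
  split_ifs <;> omega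

theorem Bmat_eq_rankOneUpdate (g j : ℕ) :
    Bmat g j = rankOneUpdate g (sumVec j) (altForm j) := by
  ext k l
  simp only [Bmat, rankOneUpdate, sumVec, altForm, of_apply, Matrix.add_apply, one_apply,
    vecMulVec_apply, Nat.succ_le_iff, ite_and]
  simp only [Nat.lt_iff_add_one_le]
  split_ifs <;> simp

theorem dotProduct_eq_pairing (g : ℕ) (w v : ℕ → ℤ) :
    (fun k : Fin g => w k) ⬝ᵥ (fun k : Fin g => v k) = pairing g w v :=
  Fin.sum_univ_eq_sum_range (fun x => w x * v x) g

theorem rankOneUpdate_mul (g : ℕ) (v w v' w' : ℕ → ℤ) :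
    rankOneUpdate g v w * rankOneUpdate g v' w' =
      1 + vecMulVec (fun k : Fin g => v k) (fun l : Fin g => w l) +
        vecMulVec (fun k : Fin g => v' k) (fun l : Fin g => w' l) +
        pairing g w v' • vecMulVec (fun k : Fin g => v k) (fun l : Fin g => w' l) := by
  rw [rankOneUpdate, rankOneUpdate, add_mul, mul_add, mul_add, one_mul, one_mul, mul_one,
    vecMulVec_mul_vecMulVec, dotProduct_eq_pairing]
  rw [vecMulVec_smul]
  abel

theorem rankOneUpdate_mul_comm {g : ℕ} {v w v' w' : ℕ → ℤ} (h : pairing g w v' = 0)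
    (h' : pairing g w' v = 0) :
    rankOneUpdate g v w * rankOneUpdate g v' w' =
      rankOneUpdate g v' w' * rankOneUpdate g v w := by
  rw [rankOneUpdate_mul, rankOneUpdate_mul, h, h']
  simp only [zero_smul, add_zero]
  abel

theorem isUnit_rankOneUpdate {g : ℕ} {v w : ℕ → ℤ} (h : IsUnit (1 + pairing g w v)) :
    IsUnit (rankOneUpdate g v w) := by
  rwa [Matrix.isUnit_iff_isUnit_det, rankOneUpdate, vecMulVec_eq Unit,
    det_one_add_replicateCol_mul_replicateRow, dotProduct_eq_pairing]

theorem pairing_twistVec {g j : ℕ} (hj : 1 ≤ j) (hjg : j < g) (w : ℕ → ℤ) :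
    pairing g w (twistVec j) = w (j - 1) + w j := by
  have h : ∀ x ∈ range g, w x * twistVec j x =
      (if x = j - 1 then w x else 0) + if x = j then w x else 0 := by
    intro x _
    unfold twistVec
    split_ifs <;> omega
  rw [pairing, sum_congr rfl h, sum_add_distrib, sum_ite_eq', sum_ite_eq',
    if_pos (by simp; omega), if_pos (by simpa)]

theorem pairing_twistForm {g j : ℕ} (hj : 1 ≤ j) (hjg : j < g) (v : ℕ → ℤ) :
    pairing g (twistForm j) v = v j - v (j - 1) := by
  have h : ∀ x ∈ range g, twistForm j x * v x =
      (if x = j then v x else 0) - if x = j - 1 then v x else 0 := by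
    intro x _
    unfold twistForm
    split_ifs <;> omega
  rw [pairing, sum_congr rfl h, sum_sub_distrib, sum_ite_eq', sum_ite_eq',
    if_pos (by simpa), if_pos (by simp; omega)]

theorem pairing_altForm_sumVec {g j : ℕ} (hj : 2 * j + 2 ≤ g) :
    pairing g (altForm j) (sumVec j) = 0 := by
  have h : ∀ x ∈ range g, altForm j x * sumVec j x =
      if x < 2 * j + 2 then (-1) ^ (x + 1) else 0 := by
    intro x _
    unfold altForm sumVec
    split_ifs <;> simp
  have hf : (range g).filter (· < 2 * j + 2) = range (2 * j + 2) := by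
    ext x
    simp only [mem_filter, mem_range]
    omega
  rw [pairing, sum_congr rfl h, ← sum_filter, hf]
  simp_rw [pow_succ]
  rw [← sum_mul, neg_one_geom_sum, if_pos (by simp [parity_simps]), zero_mul]

theorem isUnit_Tmat {g j : ℕ} (hj : 1 ≤ j) (hjg : j < g) : IsUnit (Tmat g j) := by
  rw [Tmat_eq_rankOneUpdate]
  apply isUnit_rankOneUpdate
  rw [pairing_twistForm hj hjg]
  have h1 : twistVec j j = 1 := by simp [twistVec]
  have h2 : twistVec j (j - 1) = 1 := by simp [twistVec]; omega
  simp [h1, h2]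

theorem isUnit_Umat {g j : ℕ} (hj : 1 ≤ j) (hjg : j < g) : IsUnit (Umat g j) := by
  rw [Umat_eq_rankOneUpdate]
  apply isUnit_rankOneUpdate
  rw [pairing_twistForm hj hjg]
  have h1 : twistForm j j = 1 := by simp [twistForm]
  have h2 : twistForm j (j - 1) = -1 := by simp [twistForm]; omega
  simp only [Pi.neg_apply, h1, h2]
  decide

theorem isUnit_Bmat {g j : ℕ} (hj : 2 * j + 2 ≤ g) : IsUnit (Bmat g j) := by
  rw [Bmat_eq_rankOneUpdate]
  apply isUnit_rankOneUpdate
  simp [pairing_altForm_sumVec hj]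

theorem Tmat_mul_Tmat_comm {g j k : ℕ} (hj : 1 ≤ j) (hjg : j < g) (hk : 1 ≤ k) (hkg : k < g)
    (hjk : j + 1 < k ∨ k + 1 < j) : Tmat g j * Tmat g k = Tmat g k * Tmat g j := by
  rw [Tmat_eq_rankOneUpdate, Tmat_eq_rankOneUpdate]
  apply rankOneUpdate_mul_comm
  · rw [pairing_twistForm hj hjg]
    unfold twistVec
    split_ifs <;> omega
  · rw [pairing_twistForm hk hkg]
    unfold twistVec
    split_ifs <;> omega

theorem Umat_mul_Tmat_comm {g j k : ℕ} (hj : 1 ≤ j) (hjg : j < g) (hk : 1 ≤ k) (hkg : k < g)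
    (hjk : j + 1 < k ∨ k + 1 < j) : Umat g j * Tmat g k = Tmat g k * Umat g j := by
  rw [Tmat_eq_rankOneUpdate, Umat_eq_rankOneUpdate]
  apply rankOneUpdate_mul_comm
  · rw [pairing_twistForm hj hjg]
    unfold twistVec
    split_ifs <;> omega
  · rw [pairing_twistForm hk hkg]
    simp only [twistForm, Pi.neg_apply]
    split_ifs <;> omega

theorem Tmat_mul_Bmat_comm {g j k : ℕ} (hj : 1 ≤ j) (hjg : j < g) (hjk : j ≠ 2 * k + 2) :
    Tmat g j * Bmat g k = Bmat g k * Tmat g j := by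
  rw [Tmat_eq_rankOneUpdate, Bmat_eq_rankOneUpdate]
  obtain ⟨i, rfl⟩ := Nat.exists_eq_add_of_le' hj
  apply rankOneUpdate_mul_comm
  · rw [pairing_twistForm hj hjg]
    simp only [sumVec, Nat.add_sub_cancel]
    split_ifs <;> omega
  · rw [pairing_twistVec hj hjg]
    simp only [altForm, Nat.add_sub_cancel]
    split_ifs
    · ring
    all_goals omega

/-- Two transvections whose pairings are `1` and `-1` satisfy the braid relation. -/
theorem rankOneUpdate_braid {g : ℕ} {v w v' w' : ℕ → ℤ} (hv : pairing g w v = 0)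
    (hv' : pairing g w' v' = 0) (h : pairing g w v' * pairing g w' v = -1) :
    rankOneUpdate g v w * rankOneUpdate g v' w' * rankOneUpdate g v w =
      rankOneUpdate g v' w' * rankOneUpdate g v w * rankOneUpdate g v' w' := by
  have key : ∀ p q p' q' : ℕ → ℤ,
      vecMulVec (fun k : Fin g => p k) (fun l : Fin g => q l) *
        vecMulVec (fun k : Fin g => p' k) (fun l : Fin g => q' l) =
      pairing g q p' • vecMulVec (fun k : Fin g => p k) (fun l : Fin g => q' l) := by
    intro p q p' q'
    rw [vecMulVec_mul_vecMulVec, dotProduct_eq_pairing, vecMulVec_smul]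
  simp only [rankOneUpdate, add_mul, mul_add, one_mul, mul_one, key, smul_mul_assoc, smul_smul,
    hv, hv', h, mul_comm (pairing g w' v), zero_smul, add_zero]
  module

theorem Tmat_braid {g j : ℕ} (hj : 1 ≤ j) (hjg : j + 1 < g) :
    Tmat g j * Tmat g (j + 1) * Tmat g j = Tmat g (j + 1) * Tmat g j * Tmat g (j + 1) := by
  obtain ⟨i, rfl⟩ := Nat.exists_eq_add_of_le' hj
  simp only [Tmat_eq_rankOneUpdate]
  apply rankOneUpdate_braid <;>
    simp [pairing_twistForm hj (Nat.lt_of_succ_lt hjg), pairing_twistForm (Nat.le_add_left 1 _) hjg,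
      twistVec, show i ≠ i + 1 + 1 by omega, show i + 1 + 1 ≠ i by omega]

/-- Columns: `γ_1 + ⋯ + γ_{2d+1}`, followed by `γ_{2d+2}, …, γ_{2d+n}`. -/
def frameVecs (g n d : ℕ) : Matrix (Fin g) (Fin n) ℤ :=
  Matrix.of fun x i => if x.1 - 2 * d = i.1 then 1 else 0

/-- The functionals dual to the columns of `frameVecs g n d`. -/
def frameForms (g n d : ℕ) : Matrix (Fin n) (Fin g) ℤ :=
  Matrix.of fun i x => if x.1 - 2 * d = i.1 then (-1) ^ min x.1 (2 * d) else 0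

theorem frameForms_mul_frameVecs {g n d : ℕ} (h : n + 2 * d ≤ g) :
    frameForms g n d * frameVecs g n d = 1 := by
  ext i k
  have hi := i.2
  have hsum : (frameForms g n d * frameVecs g n d) i k =
      ∑ x ∈ range g, (if x - 2 * d = i.1 then (-1 : ℤ) ^ min x (2 * d) else 0) *
        if x - 2 * d = k.1 then 1 else 0 :=
    Fin.sum_univ_eq_sum_range (fun x => (if x - 2 * d = i.1 then (-1 : ℤ) ^ min x (2 * d) else 0) *
        if x - 2 * d = k.1 then 1 else 0) g
  rw [hsum, one_apply]
  by_cases hik : i = k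
  · subst hik
    rw [if_pos rfl]
    simp only [← ite_and, mul_ite, mul_one, mul_zero, and_self]
    rw [← sum_filter]
    rcases Nat.eq_zero_or_pos i.1 with h0 | hpos
    · have hf : (range g).filter (fun x => x - 2 * d = i.1) = range (2 * d + 1) := by
        ext x
        simp only [mem_filter, mem_range]
        omega
      rw [hf, sum_congr rfl (g := fun x => (-1 : ℤ) ^ x), neg_one_geom_sum,
        if_neg (by simp [parity_simps])]
      intro x hx
      rw [min_eq_left (by simp at hx; omega)]
    · have hf : (range g).filter (fun x => x - 2 * d = i.1) = {i.1 + 2 * d} := by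
        ext x
        simp only [mem_filter, mem_range, mem_singleton]
        omega
      rw [hf, sum_singleton, min_eq_right (by omega), pow_mul]
      simp
  · rw [if_neg hik]
    refine sum_eq_zero fun x _ => ?_
    have : i.1 ≠ k.1 := fun h => hik (Fin.ext h)
    split_ifs <;> omega

/-- Matrices of size `n` acting on the span of the columns of `frameVecs g n d`, extended by the
identity on the common kernel of the dual functionals. -/
def frameHom {g n : ℕ} (d : ℕ) (h : n + 2 * d ≤ g) :
    Matrix (Fin n) (Fin n) ℤ →* Matrix (Fin g) (Fin g) ℤ where
  toFun M := 1 + frameVecs g n d * (M - 1) * frameForms g n d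
  map_one' := by simp
  map_mul' M N := by
    have key : frameVecs g n d * (M - 1) * frameForms g n d *
        (frameVecs g n d * (N - 1) * frameForms g n d) =
          frameVecs g n d * ((M - 1) * (N - 1)) * frameForms g n d := by
      calc _ = frameVecs g n d * (M - 1) * (frameForms g n d * frameVecs g n d) * (N - 1) *
            frameForms g n d := by simp only [Matrix.mul_assoc]
        _ = _ := by rw [frameForms_mul_frameVecs h]; simp only [Matrix.mul_assoc, Matrix.one_mul]
    rw [add_mul, mul_add, mul_add, key, one_mul, one_mul, mul_one, add_assoc, ← Matrix.add_mul,
      ← Matrix.mul_add, ← Matrix.add_mul, ← Matrix.mul_add]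
    congr 3
    noncomm_ring

theorem frameHom_rankOneUpdate {g n d : ℕ} (h : n + 2 * d ≤ g) {v w v' w' : ℕ → ℤ}
    (hv : ∀ x < g, v' x = if x - 2 * d < n then v (x - 2 * d) else 0)
    (hw : ∀ x < g, w' x =
      if x - 2 * d < n then w (x - 2 * d) * (-1) ^ min x (2 * d) else 0) :
    frameHom d h (rankOneUpdate n v w) = rankOneUpdate g v' w' := by
  have hV : frameVecs g n d *ᵥ (fun i => v i) = fun x : Fin g => v' x := by
    ext x
    rw [hv x x.2]
    simp only [mulVec, dotProduct, frameVecs, of_apply, ite_mul, one_mul, zero_mul]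
    rw [Fin.sum_univ_eq_sum_range (fun i => if x.1 - 2 * d = i then v i else 0) n, sum_ite_eq]
    simp only [mem_range]
  have hW : (fun i : Fin n => w i) ᵥ* frameForms g n d = fun x : Fin g => w' x := by
    ext x
    rw [hw x x.2]
    simp only [vecMul, dotProduct, frameForms, of_apply, mul_ite, mul_zero]
    rw [Fin.sum_univ_eq_sum_range
      (fun i => if x.1 - 2 * d = i then w i * (-1) ^ min x.1 (2 * d) else 0) n, sum_ite_eq]
    simp only [mem_range]
  change 1 + frameVecs g n d * (1 + vecMulVec (fun k : Fin n => v k) (fun l : Fin n => w l) - 1) *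
    frameForms g n d = _
  rw [add_sub_cancel_left, mul_vecMulVec, vecMulVec_mul, hV, hW, rankOneUpdate]

theorem frameHom_Tmat {g n d : ℕ} (h : n + 2 * d ≤ g) {j k : ℕ} (hk : 2 ≤ k) (hkn : k < n)
    (hj : j = k + 2 * d) : frameHom d h (Tmat n k) = Tmat g j := by
  rw [Tmat_eq_rankOneUpdate, Tmat_eq_rankOneUpdate]
  apply frameHom_rankOneUpdate h
  · intro x _
    unfold twistVec
    split_ifs <;> omega
  · intro x _
    rcases le_or_gt (2 * d) x with hx | hx
    · rw [min_eq_right hx, pow_mul]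
      simp only [twistForm, even_two, Even.neg_pow, one_pow, mul_one]
      split_ifs <;> omega
    · unfold twistForm
      split_ifs <;> omega

theorem frameHom_Bmat {g n d : ℕ} (h : n + 2 * d ≤ g) {j k : ℕ} (hkn : 2 * k + 2 ≤ n)
    (hj : j = k + d) : frameHom d h (Bmat n k) = Bmat g j := by
  rw [Bmat_eq_rankOneUpdate, Bmat_eq_rankOneUpdate]
  apply frameHom_rankOneUpdate h
  · intro x _
    unfold sumVec
    split_ifs <;> omega
  · intro x _
    unfold altForm
    split_ifs
    · rw [← pow_add]
      congr 1
      omega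
    all_goals omega

theorem frameHom_zero_Tmat {g n : ℕ} (h : n + 2 * 0 ≤ g) {k : ℕ} (hkn : k < n) :
    frameHom 0 h (Tmat n k) = Tmat g k := by
  rw [Tmat_eq_rankOneUpdate, Tmat_eq_rankOneUpdate]
  apply frameHom_rankOneUpdate h <;> intro x _ <;> simp [twistVec, twistForm] <;> omega

theorem frameHom_zero_Umat {g n : ℕ} (h : n + 2 * 0 ≤ g) {k : ℕ} (hkn : k < n) :
    frameHom 0 h (Umat n k) = Umat g k := by
  rw [Umat_eq_rankOneUpdate, Umat_eq_rankOneUpdate]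
  apply frameHom_rankOneUpdate h <;> intro x _ <;> simp [twistForm] <;> omega

theorem frameHom_zero_Bmat {g n : ℕ} (h : n + 2 * 0 ≤ g) {k : ℕ} (hkn : 2 * k + 2 ≤ n) :
    frameHom 0 h (Bmat n k) = Bmat g k :=
  frameHom_Bmat h hkn rfl

theorem twist_chain_pow_five :
    (Tmat 5 2 * Tmat 5 3 * Tmat 5 4 * Bmat 5 1) ^ 10 =
      (Tmat 5 1 * Tmat 5 2 * Tmat 5 3 * Tmat 5 4 * Bmat 5 1) ^ 6 := by
  have hX :
      Tmat 5 2 * Tmat 5 3 * Tmat 5 4 * Bmat 5 1 =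
      !![0, 1, -1, 1, 0; 0, 0, 0, 0, 1; 1, -2, 1, -1, 2; 1, -1, 0, -1, 2; 1, -1, 1, -2, 2] := by
    decide +kernel
  have hX5 :
      (!![0, 1, -1, 1, 0; 0, 0, 0, 0, 1; 1, -2, 1, -1, 2; 1, -1, 0, -1, 2; 1, -1, 1, -2, 2] :
        Matrix (Fin 5) (Fin 5) ℤ) ^ 5 =
      !![1, -2, 2, -2, 2; 2, -3, 2, -2, 2; 2, -2, 1, -2, 2; 2, -2, 2, -3, 2;
         2, -2, 2, -2, 1] := by
    decide +kernel
  have hX10 :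
      (!![1, -2, 2, -2, 2; 2, -3, 2, -2, 2; 2, -2, 1, -2, 2; 2, -2, 2, -3, 2;
          2, -2, 2, -2, 1] :
        Matrix (Fin 5) (Fin 5) ℤ) ^ 2 =
      !![1, 0, 0, 0, 0; 0, 1, 0, 0, 0; 0, 0, 1, 0, 0; 0, 0, 0, 1, 0; 0, 0, 0, 0, 1] := by
    decide +kernel
  have hY :
      Tmat 5 1 * Tmat 5 2 * Tmat 5 3 * Tmat 5 4 * Bmat 5 1 =
      !![0, 0, 0, 0, 1; 0, -1, 1, -1, 2; 1, -2, 1, -1, 2; 1, -1, 0, -1, 2; 1, -1, 1, -2, 2] := by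
    decide +kernel
  have hY3 :
      (!![0, 0, 0, 0, 1; 0, -1, 1, -1, 2; 1, -2, 1, -1, 2; 1, -1, 0, -1, 2; 1, -1, 1, -2, 2] :
        Matrix (Fin 5) (Fin 5) ℤ) ^ 3 =
      !![1, -1, 2, -2, 1; 1, -1, 2, -1, 0; 0, 0, 1, 0, 0; 0, -1, 2, -1, 1; 1, -2, 2, -1, 1] := by
    decide +kernel
  have hY6 :
      (!![1, -1, 2, -2, 1; 1, -1, 2, -1, 0; 0, 0, 1, 0, 0; 0, -1, 2, -1, 1; 1, -2, 2, -1, 1] :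
        Matrix (Fin 5) (Fin 5) ℤ) ^ 2 =
      !![1, 0, 0, 0, 0; 0, 1, 0, 0, 0; 0, 0, 1, 0, 0; 0, 0, 0, 1, 0; 0, 0, 0, 0, 1] := by
    decide +kernel
  rw [hX, hY, pow_mul _ 5 2, hX5, hX10, pow_mul _ 3 2, hY3, hY6]

theorem crosscap_transposition_conj :
    Bmat 5 1 * Tmat 5 4 * Umat 5 4 =
      Tmat 5 4 * Umat 5 4 * (Tmat 5 4 * Tmat 5 3 * Tmat 5 2 * Tmat 5 1 *
        Umat 5 1 * Umat 5 2 * Umat 5 3 * Umat 5 4) * Bmat 5 1 := by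
  have hT :
      Tmat 5 4 * Tmat 5 3 * Tmat 5 2 * Tmat 5 1 =
      !![0, 1, 0, 0, 0; 0, 0, 1, 0, 0; 0, 0, 0, 1, 0; 0, 0, 0, 0, 1; 1, -2, 2, -2, 2] := by
    decide +kernel
  have hTU :
      (!![0, 1, 0, 0, 0; 0, 0, 1, 0, 0; 0, 0, 0, 1, 0; 0, 0, 0, 0, 1; 1, -2, 2, -2, 2] :
        Matrix (Fin 5) (Fin 5) ℤ) * Umat 5 1 * Umat 5 2 * Umat 5 3 * Umat 5 4 =
      !![1, 0, 0, 0, 0; 0, 1, 0, 0, 0; 0, 0, 1, 0, 0; 0, 0, 0, 1, 0; -2, 2, -2, 2, 1] := by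
    decide +kernel
  have hl :
      Bmat 5 1 * Tmat 5 4 * Umat 5 4 =
      !![0, 1, -1, 1, 0; -1, 2, -1, 1, 0; -1, 1, 0, 1, 0; -1, 1, -1, 2, 0; 0, 0, 0, 2, -1] := by
    decide +kernel
  have hr :
      Tmat 5 4 * Umat 5 4 * (!![1, 0, 0, 0, 0; 0, 1, 0, 0, 0; 0, 0, 1, 0, 0; 0, 0, 0, 1, 0;
                                -2, 2, -2, 2, 1] :
        Matrix (Fin 5) (Fin 5) ℤ) * Bmat 5 1 =
      !![0, 1, -1, 1, 0; -1, 2, -1, 1, 0; -1, 1, 0, 1, 0; -1, 1, -1, 2, 0; 0, 0, 0, 2, -1] := by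
    decide +kernel
  rw [hT, hTU, hl, hr]

theorem crosscap_transposition_mul_Bmat_sq :
    (Umat 4 3 * Bmat 4 1) ^ 2 =
      (Tmat 4 1 * Tmat 4 2 * Tmat 4 3) ^ 2 * (Umat 4 1 * Umat 4 2 * Umat 4 3) ^ 2 := by
  have hT :
      Tmat 4 1 * Tmat 4 2 * Tmat 4 3 =
      !![0, 0, 0, 1; -1, 0, 0, 2; 0, -1, 0, 2; 0, 0, -1, 2] := by
    decide +kernel
  have hT2 :
      (!![0, 0, 0, 1; -1, 0, 0, 2; 0, -1, 0, 2; 0, 0, -1, 2] :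
        Matrix (Fin 4) (Fin 4) ℤ) ^ 2 =
      !![0, 0, -1, 2; 0, 0, -2, 3; 1, 0, -2, 2; 0, 1, -2, 2] := by
    decide +kernel
  have hU :
      Umat 4 1 * Umat 4 2 * Umat 4 3 =
      !![0, 0, 0, 1; 1, 0, 0, 0; 0, 1, 0, 0; 0, 0, 1, 0] := by
    decide +kernel
  have hTU :
      (!![0, 0, -1, 2; 0, 0, -2, 3; 1, 0, -2, 2; 0, 1, -2, 2] :
        Matrix (Fin 4) (Fin 4) ℤ) *
        !![0, 0, 0, 1; 1, 0, 0, 0; 0, 1, 0, 0; 0, 0, 1, 0] ^ 2 =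
      !![-1, 2, 0, 0; -2, 3, 0, 0; -2, 2, 1, 0; -2, 2, 0, 1] := by
    decide +kernel
  have hl :
      (Umat 4 3 * Bmat 4 1) ^ 2 =
      !![-1, 2, 0, 0; -2, 3, 0, 0; -2, 2, 1, 0; -2, 2, 0, 1] := by
    decide +kernel
  rw [hT, hT2, hU, hTU, hl]

theorem twist_chain_pow_seven :
    (Tmat 7 2 * Tmat 7 3 * Tmat 7 4 * Tmat 7 5 * Tmat 7 6 * Bmat 7 1) ^ 12 =
      (Tmat 7 1 * Tmat 7 2 * Tmat 7 3 * Tmat 7 4 * Tmat 7 5 * Tmat 7 6 * Bmat 7 1) ^ 9 := by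
  have hX :
      Tmat 7 2 * Tmat 7 3 * Tmat 7 4 * Tmat 7 5 * Tmat 7 6 * Bmat 7 1 =
      !![0, 1, -1, 1, 0, 0, 0; 0, 0, 0, 0, 0, 0, 1; 1, -2, 1, -1, 0, 0, 2;
         1, -1, 0, -1, 0, 0, 2; 1, -1, 1, -2, 0, 0, 2; 0, 0, 0, 0, -1, 0, 2;
         0, 0, 0, 0, 0, -1, 2] := by
    decide +kernel
  have hX3 :
      (!![0, 1, -1, 1, 0, 0, 0; 0, 0, 0, 0, 0, 0, 1; 1, -2, 1, -1, 0, 0, 2;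
          1, -1, 0, -1, 0, 0, 2; 1, -1, 1, -2, 0, 0, 2; 0, 0, 0, 0, -1, 0, 2;
          0, 0, 0, 0, 0, -1, 2] :
        Matrix (Fin 7) (Fin 7) ℤ) ^ 3 =
      !![-1, 2, -1, 1, 0, -1, 1; 0, 0, 0, 0, 1, -2, 2; 1, -1, 0, -1, 2, -2, 2;
         1, -1, 0, -2, 2, -1, 2; 2, -3, 1, -3, 2, -1, 3; 1, -1, 0, -2, 2, -2, 3;
         1, -1, 1, -2, 2, -2, 2] := by
    decide +kernel
  have hX6 :
      (!![-1, 2, -1, 1, 0, -1, 1; 0, 0, 0, 0, 1, -2, 2; 1, -1, 0, -1, 2, -2, 2;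
          1, -1, 0, -2, 2, -1, 2; 2, -3, 1, -3, 2, -1, 3; 1, -1, 0, -2, 2, -2, 3;
          1, -1, 1, -2, 2, -2, 2] :
        Matrix (Fin 7) (Fin 7) ℤ) ^ 2 =
      !![1, -2, 2, -2, 2, -2, 2; 2, -3, 3, -3, 2, -1, 1; 2, -3, 3, -3, 1, 0, 1;
         2, -3, 3, -3, 1, -1, 2; 2, -2, 3, -3, 1, -1, 1; 2, -3, 4, -3, 1, -1, 1;
         2, -3, 3, -2, 1, -1, 1] := by
    decide +kernel
  have hX12 :
      (!![1, -2, 2, -2, 2, -2, 2; 2, -3, 3, -3, 2, -1, 1; 2, -3, 3, -3, 1, 0, 1;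
          2, -3, 3, -3, 1, -1, 2; 2, -2, 3, -3, 1, -1, 1; 2, -3, 4, -3, 1, -1, 1;
          2, -3, 3, -2, 1, -1, 1] :
        Matrix (Fin 7) (Fin 7) ℤ) ^ 2 =
      !![1, 0, 0, 0, 0, 0, 0; 0, 1, 0, 0, 0, 0, 0; 0, 0, 1, 0, 0, 0, 0; 0, 0, 0, 1, 0, 0, 0;
         0, 0, 0, 0, 1, 0, 0; 0, 0, 0, 0, 0, 1, 0; 0, 0, 0, 0, 0, 0, 1] := by
    decide +kernel
  have hY :
      Tmat 7 1 * Tmat 7 2 * Tmat 7 3 * Tmat 7 4 * Tmat 7 5 * Tmat 7 6 * Bmat 7 1 =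
      !![0, 0, 0, 0, 0, 0, 1; 0, -1, 1, -1, 0, 0, 2; 1, -2, 1, -1, 0, 0, 2;
         1, -1, 0, -1, 0, 0, 2; 1, -1, 1, -2, 0, 0, 2; 0, 0, 0, 0, -1, 0, 2;
         0, 0, 0, 0, 0, -1, 2] := by
    decide +kernel
  have hY3 :
      (!![0, 0, 0, 0, 0, 0, 1; 0, -1, 1, -1, 0, 0, 2; 1, -2, 1, -1, 0, 0, 2;
          1, -1, 0, -1, 0, 0, 2; 1, -1, 1, -2, 0, 0, 2; 0, 0, 0, 0, -1, 0, 2;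
          0, 0, 0, 0, 0, -1, 2] :
        Matrix (Fin 7) (Fin 7) ℤ) ^ 3 =
      !![0, 0, 0, 0, 1, -2, 2; 1, -1, 0, -1, 2, -2, 2; 1, -1, 0, -2, 2, -1, 2;
         1, -2, 1, -3, 2, -1, 3; 2, -3, 1, -3, 2, -1, 3; 1, -1, 0, -2, 2, -2, 3;
         1, -1, 1, -2, 2, -2, 2] := by
    decide +kernel
  have hY9 :
      (!![0, 0, 0, 0, 1, -2, 2; 1, -1, 0, -1, 2, -2, 2; 1, -1, 0, -2, 2, -1, 2;
          1, -2, 1, -3, 2, -1, 3; 2, -3, 1, -3, 2, -1, 3; 1, -1, 0, -2, 2, -2, 3;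
          1, -1, 1, -2, 2, -2, 2] :
        Matrix (Fin 7) (Fin 7) ℤ) ^ 3 =
      !![1, 0, 0, 0, 0, 0, 0; 0, 1, 0, 0, 0, 0, 0; 0, 0, 1, 0, 0, 0, 0; 0, 0, 0, 1, 0, 0, 0;
         0, 0, 0, 0, 1, 0, 0; 0, 0, 0, 0, 0, 1, 0; 0, 0, 0, 0, 0, 0, 1] := by
    decide +kernel
  rw [hX, hY, pow_mul _ 6 2, pow_mul _ 3 2, hX3, hX6, hX12, pow_mul _ 3 3, hY3, hY9]

theorem Bmat_two_chain :
    Bmat 6 2 * (Bmat 6 0 * Tmat 6 2 * Tmat 6 3 * Tmat 6 4 * Tmat 6 5) ^ 6 =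
      (Bmat 6 0 * Tmat 6 2 * Tmat 6 3 * Tmat 6 4 * Tmat 6 5 * Bmat 6 1) ^ 5 := by
  have hX :
      Bmat 6 0 * Tmat 6 2 * Tmat 6 3 * Tmat 6 4 * Tmat 6 5 =
      !![0, 0, 0, 0, 0, 1; -1, 0, 0, 0, 0, 2; 0, -1, 0, 0, 0, 2; 0, 0, -1, 0, 0, 2;
         0, 0, 0, -1, 0, 2; 0, 0, 0, 0, -1, 2] := by
    decide +kernel
  have hX3 :
      (!![0, 0, 0, 0, 0, 1; -1, 0, 0, 0, 0, 2; 0, -1, 0, 0, 0, 2; 0, 0, -1, 0, 0, 2;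
          0, 0, 0, -1, 0, 2; 0, 0, 0, 0, -1, 2] :
        Matrix (Fin 6) (Fin 6) ℤ) ^ 3 =
      !![0, 0, 0, 1, -2, 2; 0, 0, 0, 2, -3, 2; 0, 0, 0, 2, -2, 1; -1, 0, 0, 2, -2, 2;
         0, -1, 0, 2, -2, 2; 0, 0, -1, 2, -2, 2] := by
    decide +kernel
  have hX6 :
      (!![0, 0, 0, 1, -2, 2; 0, 0, 0, 2, -3, 2; 0, 0, 0, 2, -2, 1; -1, 0, 0, 2, -2, 2;
          0, -1, 0, 2, -2, 2; 0, 0, -1, 2, -2, 2] :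
        Matrix (Fin 6) (Fin 6) ℤ) ^ 2 =
      !![-1, 2, -2, 2, -2, 2; -2, 3, -2, 2, -2, 2; -2, 2, -1, 2, -2, 2; -2, 2, -2, 3, -2, 2;
         -2, 2, -2, 2, -1, 2; -2, 2, -2, 2, -2, 3] := by
    decide +kernel
  have hB :
      Bmat 6 2 * (!![-1, 2, -2, 2, -2, 2; -2, 3, -2, 2, -2, 2; -2, 2, -1, 2, -2, 2;
                     -2, 2, -2, 3, -2, 2; -2, 2, -2, 2, -1, 2; -2, 2, -2, 2, -2, 3] :
        Matrix (Fin 6) (Fin 6) ℤ) =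
      !![-2, 3, -3, 3, -3, 3; -3, 4, -3, 3, -3, 3; -3, 3, -2, 3, -3, 3; -3, 3, -3, 4, -3, 3;
         -3, 3, -3, 3, -2, 3; -3, 3, -3, 3, -3, 4] := by
    decide +kernel
  have hY :
      Bmat 6 0 * Tmat 6 2 * Tmat 6 3 * Tmat 6 4 * Tmat 6 5 * Bmat 6 1 =
      !![0, 0, 0, 0, 0, 1; 0, -1, 1, -1, 0, 2; 1, -2, 1, -1, 0, 2; 1, -1, 0, -1, 0, 2;
         1, -1, 1, -2, 0, 2; 0, 0, 0, 0, -1, 2] := by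
    decide +kernel
  have hY5 :
      (!![0, 0, 0, 0, 0, 1; 0, -1, 1, -1, 0, 2; 1, -2, 1, -1, 0, 2; 1, -1, 0, -1, 0, 2;
          1, -1, 1, -2, 0, 2; 0, 0, 0, 0, -1, 2] :
        Matrix (Fin 6) (Fin 6) ℤ) ^ 5 =
      !![-2, 3, -3, 3, -3, 3; -3, 4, -3, 3, -3, 3; -3, 3, -2, 3, -3, 3; -3, 3, -3, 4, -3, 3;
         -3, 3, -3, 3, -2, 3; -3, 3, -3, 3, -3, 4] := by
    decide +kernel
  rw [hY, hX, pow_mul _ 3 2, hX3, hX6, hB, hY5]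

theorem Bmat_chain {g j : ℕ} (hj : 1 ≤ j) (hjg : 2 * j + 4 ≤ g) :
    Bmat g (j + 1) * (Bmat g (j - 1) * Tmat g (2 * j) * Tmat g (2 * j + 1) *
        Tmat g (2 * j + 2) * Tmat g (2 * j + 3)) ^ 6 =
      (Bmat g (j - 1) * Tmat g (2 * j) * Tmat g (2 * j + 1) * Tmat g (2 * j + 2) *
        Tmat g (2 * j + 3) * Bmat g j) ^ 5 := by
  have h : 6 + 2 * (j - 1) ≤ g := by omega
  have key := congrArg (frameHom (j - 1) h) Bmat_two_chain
  simp only [map_mul, map_pow] at key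
  rwa [frameHom_Bmat h (j := j + 1) (by omega) (by omega),
    frameHom_Bmat h (j := j - 1) (by omega) (by omega),
    frameHom_Bmat h (j := j) (by omega) (by omega),
    frameHom_Tmat h (j := 2 * j) (by omega) (by omega) (by omega),
    frameHom_Tmat h (j := 2 * j + 1) (by omega) (by omega) (by omega),
    frameHom_Tmat h (j := 2 * j + 2) (by omega) (by omega) (by omega),
    frameHom_Tmat h (j := 2 * j + 3) (by omega) (by omega) (by omega)] at key

theorem Bmat_zero (g : ℕ) : Bmat g 0 = Tmat g 1 := by
  rw [Bmat_eq_rankOneUpdate, Tmat_eq_rankOneUpdate]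
  have hv : sumVec 0 = twistVec 1 := by
    funext x
    unfold sumVec twistVec
    split_ifs <;> omega
  have hw : altForm 0 = twistForm 1 := by
    funext x
    match x with
    | 0 => rfl
    | 1 => rfl
    | x + 2 => simp [altForm, twistForm]
  rw [hv, hw]

theorem satG1_matrices {g : ℕ} (hg : 3 ≤ g) :
    SatG1 g (fun j => Tmat g j) (fun j => Umat g j) (fun j => Bmat g j) where
  A1 j k hj hjg hk hkg hjk := by
    refine Tmat_mul_Tmat_comm hj (by omega) hk (by omega) ?_
    rw [lt_abs] at hjk
    omega
  A2 j hj hjg := Tmat_braid hj (by omega)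
  A3 j _ hj hjg hj4 := Tmat_mul_Bmat_comm hj (by omega) (by omega)
  A4 h := by
    have r : Bmat 5 1 * Tmat 5 4 * Bmat 5 1 = Tmat 5 4 * Bmat 5 1 * Tmat 5 4 := by decide +kernel
    simpa [frameHom_zero_Tmat, frameHom_zero_Bmat] using
      congrArg (frameHom 0 (show 5 + 2 * 0 ≤ g by omega)) r
  A5 h := by
    simpa [frameHom_zero_Tmat, frameHom_zero_Bmat, mul_assoc] using
      congrArg (frameHom 0 (show 5 + 2 * 0 ≤ g by omega)) twist_chain_pow_five
  A6 h := by
    simpa [frameHom_zero_Tmat, frameHom_zero_Bmat, mul_assoc] using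
      congrArg (frameHom 0 (show 7 + 2 * 0 ≤ g by omega)) twist_chain_pow_seven
  B1 h := by
    have r : Umat 4 1 * Umat 4 3 = Umat 4 3 * Umat 4 1 := by decide +kernel
    simpa [frameHom_zero_Umat] using congrArg (frameHom 0 (show 4 + 2 * 0 ≤ g by omega)) r
  B2 := by
    have r : Umat 3 1 * Umat 3 2 * Umat 3 1 = Umat 3 2 * Umat 3 1 * Umat 3 2 := by decide +kernel
    simpa [frameHom_zero_Umat] using congrArg (frameHom 0 (show 3 + 2 * 0 ≤ g by omega)) r
  C1 j hj hjg := Umat_mul_Tmat_comm le_rfl (by omega) (by omega) (by omega) (by omega)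
  C2 := by
    have r : Tmat 3 1 * Umat 3 2 * Umat 3 1 = Umat 3 2 * Umat 3 1 * Tmat 3 2 := by decide +kernel
    simpa [frameHom_zero_Tmat, frameHom_zero_Umat] using
      congrArg (frameHom 0 (show 3 + 2 * 0 ≤ g by omega)) r
  C4 := by
    have r : Tmat 3 1 * Umat 3 1 * Tmat 3 1 = Umat 3 1 := by decide +kernel
    simpa [frameHom_zero_Tmat, frameHom_zero_Umat] using
      congrArg (frameHom 0 (show 3 + 2 * 0 ≤ g by omega)) r
  C5 j hj hjm := by
    have r : ∀ i < 5, 1 ≤ i → Umat (i + 2) (i + 1) * Tmat (i + 2) i * Tmat (i + 2) (i + 1) *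
        Umat (i + 2) i = Tmat (i + 2) i * Tmat (i + 2) (i + 1) := by decide +kernel
    simpa [frameHom_zero_Tmat, frameHom_zero_Umat] using
      congrArg (frameHom 0 (show j + 2 + 2 * 0 ≤ g by omega)) (r j (by omega) hj)
  C6 h := by
    simpa [frameHom_zero_Tmat, frameHom_zero_Umat, frameHom_zero_Bmat] using
      congrArg (frameHom 0 (show 4 + 2 * 0 ≤ g by omega)) crosscap_transposition_mul_Bmat_sq
  C7 h := by
    have r : Umat 6 5 * Bmat 6 1 = Bmat 6 1 * Umat 6 5 := by decide +kernel
    simpa [frameHom_zero_Umat, frameHom_zero_Bmat] using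
      congrArg (frameHom 0 (show 6 + 2 * 0 ≤ g by omega)) r
  C8 h := by
    simpa [frameHom_zero_Tmat, frameHom_zero_Umat, frameHom_zero_Bmat] using
      congrArg (frameHom 0 (show 5 + 2 * 0 ≤ g by omega)) crosscap_transposition_conj
  A7 _ _ := Bmat_zero g
  A8 _ h j hj hjg := Bmat_chain hj (by omega)
  A9a h := by
    subst h
    decide +kernel
  A9b _ h := (Tmat_mul_Bmat_comm (by omega) (by omega) (by omega)).symm

/-- The relations may be tested after an injective homomorphism, on the generators present. -/
theorem SatG1.of_injective {H K : Type*} [Monoid H] [Monoid K] {g : ℕ} (hg : 3 ≤ g)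
    {a u b : ℕ → K} (h : SatG1 g a u b) {f : H →* K} (hf : Function.Injective f)
    {a' u' b' : ℕ → H} (ha : ∀ j, 1 ≤ j → j ≤ g - 1 → f (a' j) = a j)
    (hu : ∀ j, 1 ≤ j → j ≤ min 5 (g - 1) → f (u' j) = u j)
    (hb : ∀ j, bIdx g j → f (b' j) = b j) : SatG1 g a' u' b' := by
  have hb1 : 4 ≤ g → f (b' 1) = b 1 := fun h4 => hb 1 (Or.inl ⟨h4, rfl⟩)
  have hbe : Even g → 6 ≤ g → ∀ j ≤ (g - 2) / 2, f (b' j) = b j :=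
    fun he h6 j hj => hb j (Or.inr ⟨he, h6, hj⟩)
  constructor <;> intros <;> apply hf <;>
    simp (disch := first | assumption | omega) only [map_mul, map_pow, ha, hu, hb1]
  · exact h.A1 _ _ ‹_› ‹_› ‹_› ‹_› ‹_›
  · exact h.A2 _ ‹_› ‹_›
  · exact h.A3 _ ‹_› ‹_› ‹_› ‹_›
  · exact h.A4 ‹_›
  · exact h.A5 ‹_›
  · exact h.A6 ‹_›
  · exact h.B1 ‹_›
  · exact h.B2
  · exact h.C1 _ ‹_› ‹_›
  · exact h.C2
  · exact h.C4
  · exact h.C5 _ ‹_› ‹_›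
  · exact h.C6 ‹_›
  · exact h.C7 ‹_›
  · exact h.C8 ‹_›
  · simp (disch := first | assumption | omega) only [hbe, h.A7]
  · simp (disch := first | assumption | omega) only [hbe, h.A8]
  · rename_i h6
    rw [hbe (by simp [h6, parity_simps]) (by omega) 2 (by omega), h.A9a h6]
  · simp (disch := first | assumption | omega) only [hbe, h.A9b]

theorem two_mul_add_two_le_of_bIdx {g j : ℕ} (h : bIdx g j) : 2 * j + 2 ≤ g := by
  rcases h with h | h <;> omega

/-- The matrices `T_j`, `U_j`, `B_j` satisfy all the defining relations of the
Paris–Szepietowski presentation of the mapping class group of `N_{g,1}`; consequently there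
is a unique group homomorphism `ψ : G_{g,1} → GL(g,ℤ)` sending `a_j ↦ T_j`, `u_j ↦ U_j`,
`b_j ↦ B_j`. -/
theorem matrices_satisfy_relations_boundary (g : ℕ) (hg : 3 ≤ g) :
    SatG1 g (fun j => Tmat g j) (fun j => Umat g j) (fun j => Bmat g j) ∧
    (∀ (G : Type) [Group G] (a u b : ℕ → G), IsPresentedG1 g G a u b →
      ∃! ψ : G →* Matrix.GeneralLinearGroup (Fin g) ℤ,
        (∀ j, 1 ≤ j → j ≤ g - 1 → (ψ (a j) : Matrix (Fin g) (Fin g) ℤ) = Tmat g j) ∧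
        (∀ j, 1 ≤ j → j ≤ min 5 (g - 1) →
          (ψ (u j) : Matrix (Fin g) (Fin g) ℤ) = Umat g j) ∧
        (∀ j, bIdx g j → (ψ (b j) : Matrix (Fin g) (Fin g) ℤ) = Bmat g j)) := by
  refine ⟨satG1_matrices hg, fun G _ a u b hG => ?_⟩
  classical
  let toGL : Matrix (Fin g) (Fin g) ℤ → GeneralLinearGroup (Fin g) ℤ := fun M =>
    if h : IsUnit M then h.unit else 1
  have toGL_coe : ∀ {M}, IsUnit M → (toGL M : Matrix (Fin g) (Fin g) ℤ) = M := fun h => by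
    simp [toGL, h]
  have hT : ∀ j, 1 ≤ j → j ≤ g - 1 → (toGL (Tmat g j) : Matrix (Fin g) (Fin g) ℤ) = Tmat g j :=
    fun j hj hjg => toGL_coe (isUnit_Tmat hj (by omega))
  have hU : ∀ j, 1 ≤ j → j ≤ min 5 (g - 1) →
      (toGL (Umat g j) : Matrix (Fin g) (Fin g) ℤ) = Umat g j :=
    fun j hj hjm => toGL_coe (isUnit_Umat hj (by omega))
  have hB : ∀ j, bIdx g j → (toGL (Bmat g j) : Matrix (Fin g) (Fin g) ℤ) = Bmat g j :=
    fun j hj => toGL_coe (isUnit_Bmat (two_mul_add_two_le_of_bIdx hj))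
  have hsat : SatG1 g (fun j => toGL (Tmat g j)) (fun j => toGL (Umat g j))
      (fun j => toGL (Bmat g j)) :=
    (satG1_matrices hg).of_injective hg (f := Units.coeHom _) Units.val_injective hT hU hB
  obtain ⟨ψ, ⟨hψa, hψu, hψb⟩, huniq⟩ := hG.2 _ _ _ _ hsat
  refine ⟨ψ, ⟨fun j hj hjg => ?_, fun j hj hjm => ?_, fun j hj => ?_⟩, ?_⟩
  · rw [hψa j hj hjg, hT j hj hjg]
  · rw [hψu j hj hjm, hU j hj hjm]
  · rw [hψb j hj, hB j hj]
  · rintro φ ⟨hφa, hφu, hφb⟩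
    refine huniq φ ⟨fun j hj hjg => ?_, fun j hj hjm => ?_, fun j hj => ?_⟩ <;> apply Units.ext
    · rw [hφa j hj hjg, hT j hj hjg]
    · rw [hφu j hj hjm, hU j hj hjm]
    · rw [hφb j hj, hB j hj]
end

section
/- Let j ≥ 1 and g ≥ 2j+4 be integers, let (γ_1,…,γ_g) be the standard basis of (ℤ/2)^g, and let M be the ℤ/2-linear endomorphism of (ℤ/2)^g defined by: M(γ_i) = γ_i + (γ_1+⋯+γ_{2j−1}) + γ_{2j+4} for 1 ≤ i ≤ 2j−1; M(γ_{2j}) = γ_1+⋯+γ_{2j−1}; M(γ_i) = γ_{i−1} for 2j+1 ≤ i ≤ 2j+4; and M(γ_i) = γ_i for i > 2j+4. Then the endomorphism A = Σ_{p=0}^{5} M^p satisfies A(γ_i) = γ_1+γ_2+⋯+γ_{2j+4} for every i ≤ 2j+4, and A(γ_i) = 0 for every i > 2j+4. -/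
/-- The basis vector `γ_i` (1-based index `i`) of `(ℤ/2)^g`. -/
def gam2 (g i : ℕ) : Fin g → ZMod 2 := fun k => if k.1 + 1 = i then 1 else 0

/-- The vector `γ_1 + γ_2 + ⋯ + γ_n` in `(ℤ/2)^g`. -/
def gamSum2 (g n : ℕ) : Fin g → ZMod 2 := fun k => if k.1 + 1 ≤ n then 1 else 0

theorem gamSum2_zero (g : ℕ) : gamSum2 g 0 = 0 := by
  ext k
  simp [gamSum2]

theorem gamSum2_succ (g n : ℕ) : gamSum2 g (n + 1) = gamSum2 g n + gam2 g (n + 1) := by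
  ext k
  simp only [gamSum2, gam2, Pi.add_apply]
  split_ifs <;> first | omega | simp

/-- If an endomorphism moves each of `γ_1, …, γ_n` by the same vector `w`, then it moves their
sum by `n • w`. -/
theorem map_gamSum2_of_map_gam2 {g : ℕ} (M : Module.End (ZMod 2) (Fin g → ZMod 2))
    (w : Fin g → ZMod 2) (n : ℕ) (h : ∀ i, 1 ≤ i → i ≤ n → M (gam2 g i) = gam2 g i + w) :
    M (gamSum2 g n) = gamSum2 g n + n • w := by
  induction n with
  | zero => simp [gamSum2_zero]
  | succ n ih =>
    rw [gamSum2_succ, map_add, ih fun i h₁ h₂ => h i h₁ (by omega), h (n + 1) (by omega) le_rfl]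
    module

section SixTermSum

variable {V : Type*} [AddCommGroup V] [Module (ZMod 2) V] (M : Module.End (ZMod 2) V)

theorem sum_range_six_pow_apply (v : V) :
    (∑ p ∈ Finset.range 6, M ^ p) v =
      v + M v + M (M v) + M (M (M v)) + M (M (M (M v))) + M (M (M (M (M v)))) := by
  simp [Finset.sum_range_succ, pow_succ]

theorem sum_range_six_pow_apply_of_fixed {v : V} (h : M v = v) :
    (∑ p ∈ Finset.range 6, M ^ p) v = 0 := by
  simp only [sum_range_six_pow_apply, h]
  linear_combination (norm := module) (3 : ℕ) • ZModModule.add_self v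

/-- If `M` carries `s ↦ e₄ ↦ e₃ ↦ e₂ ↦ e₁ ↦ e₀` and `v ↦ v + s + e₄`, then `1 + M + ⋯ + M ^ 5`
sends `v` to the sum of the chain. -/
theorem sum_range_six_pow_apply_of_add {v s e₀ e₁ e₂ e₃ e₄ : V} (hs : M s = e₄) (h₄ : M e₄ = e₃)
    (h₃ : M e₃ = e₂) (h₂ : M e₂ = e₁) (h₁ : M e₁ = e₀) (h : M v = v + s + e₄) :
    (∑ p ∈ Finset.range 6, M ^ p) v = s + e₀ + e₁ + e₂ + e₃ + e₄ := by
  simp only [sum_range_six_pow_apply, h, map_add, hs, h₄, h₃, h₂, h₁]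
  linear_combination (norm := module) (3 : ℕ) • ZModModule.add_self v +
    (2 : ℕ) • ZModModule.add_self s + (4 : ℕ) • ZModModule.add_self e₄ +
    (3 : ℕ) • ZModModule.add_self e₃ + (2 : ℕ) • ZModModule.add_self e₂ +
    ZModModule.add_self e₁

end SixTermSum

/-- Relation (A8) analysis: if `M` is the mod 2 reduction of the action of
`u_{2j+3}u_{2j+2}u_{2j+1}u_{2j}b_{j-1}⁻¹` on `H_1(N_{g,1};ℤ) ≅ ℤ^g` (described on the
basis `γ_1, …, γ_g` as in the hypotheses), then `A = Σ_{p=0}^{5} M^p` satisfies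
`A(γ_i) = γ_1 + ⋯ + γ_{2j+4}` for `i ≤ 2j+4` and `A(γ_i) = 0` for `i > 2j+4`. -/
theorem relation_A8_M_sum (g j : ℕ) (hj : 1 ≤ j) (hg : 2 * j + 4 ≤ g)
    (M : Module.End (ZMod 2) (Fin g → ZMod 2))
    (hM1 : ∀ i, 1 ≤ i → i ≤ 2 * j - 1 →
      M (gam2 g i) = gam2 g i + gamSum2 g (2 * j - 1) + gam2 g (2 * j + 4))
    (hM2 : M (gam2 g (2 * j)) = gamSum2 g (2 * j - 1))
    (hM3 : ∀ i, 2 * j + 1 ≤ i → i ≤ 2 * j + 4 → M (gam2 g i) = gam2 g (i - 1))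
    (hM4 : ∀ i, 2 * j + 4 < i → i ≤ g → M (gam2 g i) = gam2 g i) :
    (∀ i, 1 ≤ i → i ≤ 2 * j + 4 →
      (∑ p ∈ Finset.range 6, M ^ p) (gam2 g i) = gamSum2 g (2 * j + 4)) ∧
    (∀ i, 2 * j + 4 < i → i ≤ g →
      (∑ p ∈ Finset.range 6, M ^ p) (gam2 g i) = 0) := by
  obtain ⟨n, rfl⟩ : ∃ n, j = n + 1 := ⟨j - 1, by omega⟩
  have hS : M (gamSum2 g (2 * (n + 1) - 1)) = gam2 g (2 * (n + 1) + 4) := by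
    rw [map_gamSum2_of_map_gam2 M _ _ fun i h₁ h₂ => (hM1 i h₁ h₂).trans (add_assoc _ _ _),
      ← Nat.cast_smul_eq_nsmul (ZMod 2),
      ZMod.natCast_eq_one_iff_odd.mpr ⟨n, by omega⟩]
    linear_combination (norm := module) ZModModule.add_self (gamSum2 g (2 * (n + 1) - 1))
  have h₁ := hM3 (2 * (n + 1) + 1) (by omega) (by omega)
  have h₂ := hM3 (2 * (n + 1) + 2) (by omega) (by omega)
  have h₃ := hM3 (2 * (n + 1) + 3) (by omega) (by omega)
  have h₄ := hM3 (2 * (n + 1) + 4) (by omega) (by omega)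
  have hT : gamSum2 g (2 * (n + 1) + 4) = gamSum2 g (2 * (n + 1) - 1) + gam2 g (2 * (n + 1)) +
      gam2 g (2 * (n + 1) + 1) + gam2 g (2 * (n + 1) + 2) + gam2 g (2 * (n + 1) + 3) +
      gam2 g (2 * (n + 1) + 4) := by
    rw [gamSum2_succ g (2 * (n + 1) + 3), gamSum2_succ g (2 * (n + 1) + 2),
      gamSum2_succ g (2 * (n + 1) + 1), gamSum2_succ g (2 * (n + 1)),
      show 2 * (n + 1) = 2 * n + 1 + 1 by ring, gamSum2_succ g (2 * n + 1)]
    rfl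
  refine ⟨fun i hi₁ hi₂ => ?_, fun i hi₁ hi₂ => sum_range_six_pow_apply_of_fixed M (hM4 i hi₁ hi₂)⟩
  rw [hT]
  by_cases hi : i ≤ 2 * (n + 1) - 1
  · exact sum_range_six_pow_apply_of_add M hS h₄ h₃ h₂ h₁ (hM1 i hi₁ hi)
  · obtain rfl | rfl | rfl | rfl | rfl : i = 2 * (n + 1) ∨ i = 2 * (n + 1) + 1 ∨
        i = 2 * (n + 1) + 2 ∨ i = 2 * (n + 1) + 3 ∨ i = 2 * (n + 1) + 4 := by omega
    all_goals
      simp only [sum_range_six_pow_apply, Nat.add_sub_cancel, Nat.add_succ_sub_one, hM2, hS, h₁,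
        h₂, h₃, h₄]
      abel
end

section
/- Let j ≥ 1 and g ≥ 2j+4 be integers, let (γ_1,…,γ_g) be the standard basis of (ℤ/2)^g, and let N be the ℤ/2-linear endomorphism of (ℤ/2)^g defined by: N(γ_i) = γ_i + (γ_1+⋯+γ_{2j−1}) + γ_{2j+4} for 1 ≤ i ≤ 2j−1; N(γ_{2j}) = γ_{2j}+γ_{2j+1}+γ_{2j+2}; N(γ_i) = γ_{i−1} + (γ_1+⋯+γ_{2j+2}) for 2j+1 ≤ i ≤ 2j+3; N(γ_{2j+4}) = γ_{2j+3}; and N(γ_i) = γ_i for i > 2j+4. Then the endomorphism B = Σ_{p=0}^{4} N^p satisfies: B(γ_i) = γ_i + γ_{2j+1} + γ_{2j+3} for 1 ≤ i ≤ 2j−1; B(γ_i) = γ_{2j}+γ_{2j+2}+γ_{2j+4} for i ∈ {2j, 2j+2, 2j+4}; B(γ_i) = (γ_1+⋯+γ_{2j−1}) + γ_{2j+1} + γ_{2j+3} for i ∈ {2j+1, 2j+3}; and B(γ_i) = γ_i for i > 2j+4. -/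
/-- If `f` translates each of `γ_1, …, γ_n` by `v`, it translates their sum by `n • v`. -/
theorem map_gamSum2 {g n : ℕ} {f : Module.End (ZMod 2) (Fin g → ZMod 2)}
    {v : Fin g → ZMod 2} (h : ∀ i, 1 ≤ i → i ≤ n → f (gam2 g i) = gam2 g i + v) :
    f (gamSum2 g n) = gamSum2 g n + n • v := by
  induction n with
  | zero => simp [gamSum2_zero]
  | succ n ih =>
    rw [gamSum2_succ, map_add, ih fun i hi hin => h i hi (by omega),
      h (n + 1) (by omega) le_rfl, add_smul, one_smul]
    abel

theorem sum_range_five_pow_apply {R M : Type*} [Semiring R] [AddCommMonoid M] [Module R M]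
    (f : Module.End R M) (x : M) :
    (∑ p ∈ Finset.range 5, f ^ p) x
      = x + f x + f (f x) + f (f (f x)) + f (f (f (f x))) := by
  simp [Finset.sum_range_succ, pow_succ]

/-- Relation (A8) analysis: if `N` is the mod 2 reduction of the action of
`b_j⁻¹(u_{2j+3}u_{2j+2}u_{2j+1}u_{2j}b_{j-1}⁻¹)` on `H_1(N_{g,1};ℤ) ≅ ℤ^g` (described on
the basis `γ_1, …, γ_g` as in the hypotheses), then `B = Σ_{p=0}^{4} N^p` is given on the
basis by the stated formulas. -/
theorem relation_A8_N_sum (g j : ℕ) (hj : 1 ≤ j) (hg : 2 * j + 4 ≤ g)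
    (N : Module.End (ZMod 2) (Fin g → ZMod 2))
    (hN1 : ∀ i, 1 ≤ i → i ≤ 2 * j - 1 →
      N (gam2 g i) = gam2 g i + gamSum2 g (2 * j - 1) + gam2 g (2 * j + 4))
    (hN2 : N (gam2 g (2 * j)) = gam2 g (2 * j) + gam2 g (2 * j + 1) + gam2 g (2 * j + 2))
    (hN3 : ∀ i, 2 * j + 1 ≤ i → i ≤ 2 * j + 3 →
      N (gam2 g i) = gam2 g (i - 1) + gamSum2 g (2 * j + 2))
    (hN4 : N (gam2 g (2 * j + 4)) = gam2 g (2 * j + 3))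
    (hN5 : ∀ i, 2 * j + 4 < i → i ≤ g → N (gam2 g i) = gam2 g i) :
    (∀ i, 1 ≤ i → i ≤ 2 * j - 1 →
      (∑ p ∈ Finset.range 5, N ^ p) (gam2 g i)
        = gam2 g i + gam2 g (2 * j + 1) + gam2 g (2 * j + 3)) ∧
    (∀ i, i = 2 * j ∨ i = 2 * j + 2 ∨ i = 2 * j + 4 →
      (∑ p ∈ Finset.range 5, N ^ p) (gam2 g i)
        = gam2 g (2 * j) + gam2 g (2 * j + 2) + gam2 g (2 * j + 4)) ∧
    (∀ i, i = 2 * j + 1 ∨ i = 2 * j + 3 →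
      (∑ p ∈ Finset.range 5, N ^ p) (gam2 g i)
        = gamSum2 g (2 * j - 1) + gam2 g (2 * j + 1) + gam2 g (2 * j + 3)) ∧
    (∀ i, 2 * j + 4 < i → i ≤ g →
      (∑ p ∈ Finset.range 5, N ^ p) (gam2 g i) = gam2 g i) := by
  have hT : gamSum2 g (2 * j + 2)
      = gamSum2 g (2 * j - 1) + gam2 g (2 * j) + gam2 g (2 * j + 1) + gam2 g (2 * j + 2) := by
    have h2j : gamSum2 g (2 * j) = gamSum2 g (2 * j - 1) + gam2 g (2 * j) := by
      conv_lhs => rw [← Nat.sub_add_cancel (show 1 ≤ 2 * j by omega), gamSum2_succ]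
      rw [Nat.sub_add_cancel (by omega)]
    rw [gamSum2_succ, gamSum2_succ, h2j]
  have hS : N (gamSum2 g (2 * j - 1)) = gam2 g (2 * j + 4) := by
    rw [map_gamSum2 fun i hi hij => (hN1 i hi hij).trans (add_assoc _ _ _)]
    obtain ⟨m, rfl⟩ : ∃ m, j = m + 1 := ⟨j - 1, by omega⟩
    ext k
    rw [show 2 * (m + 1) - 1 = 2 * m + 1 by omega]
    simp only [Pi.add_apply, Pi.smul_apply]
    rw [nsmul_eq_mul]
    push_cast
    grind
  have hb := hN3 (2 * j + 1) (by omega) (by omega)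
  have hc := hN3 (2 * j + 2) (by omega) (by omega)
  have hd := hN3 (2 * j + 3) (by omega) (by omega)
  rw [hT, Nat.add_sub_cancel] at hb
  rw [hT, show 2 * j + 2 - 1 = 2 * j + 1 by omega] at hc
  rw [hT, show 2 * j + 3 - 1 = 2 * j + 2 by omega] at hd
  simp only [sum_range_five_pow_apply]
  refine ⟨fun i hi hij => ?_, ?_, ?_, fun i hi hig => ?_⟩
  · simp only [hN1 i hi hij, hN2, hN4, hS, hb, hc, hd, map_add]
    ext k
    simp only [Pi.add_apply]
    grind
  · rintro i (rfl | rfl | rfl) <;>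
    · simp only [hN2, hN4, hS, hb, hc, hd, map_add]
      ext k
      simp only [Pi.add_apply]
      grind
  · rintro i (rfl | rfl) <;>
    · simp only [hN2, hN4, hS, hb, hc, hd, map_add]
      ext k
      simp only [Pi.add_apply]
      grind
  · simp only [hN5 i hi hig]
    ext k
    simp only [Pi.add_apply]
    grind
end

section
/- Let g ≥ 4. Each matrix T_j fixes the vector γ_1+⋯+γ_g, hence induces an automorphism T̄_j of the quotient group M_g = ℤ^g/⟨2(γ_1+⋯+γ_g)⟩. The automorphism (T̄_1 T̄_2 ⋯ T̄_{g−1})^g of M_g equals the identity if g is even, and equals −id if g is odd. -/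
/-- The subgroup `⟨2(γ_1+⋯+γ_g)⟩` of `ℤ^g`. -/
def relSub (g : ℕ) : Submodule ℤ (Fin g → ℤ) := Submodule.span ℤ {(2 : ℤ) • onesVec g}

/-- `M_g = ℤ^g / ⟨2(γ_1+⋯+γ_g)⟩ ≅ H_1(N_g; ℤ)`. -/
abbrev Mg (g : ℕ) := (Fin g → ℤ) ⧸ relSub g

/-- `Tb j` is the endomorphism `T̄_j` of `M_g` induced by the matrix `T_j`. -/
def TbCompat (g : ℕ) (Tb : ℕ → Module.End ℤ (Mg g)) : Prop :=
  ∀ j, 1 ≤ j → j ≤ g - 1 → ∀ x : Fin g → ℤ,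
    Tb j (Submodule.Quotient.mk x) = Submodule.Quotient.mk ((Tmat g j).mulVec x)

/-- `T_j` replaces `(x_j, x_{j+1})` by `(x_{j+1}, 2 x_{j+1} - x_j)`. -/
theorem Tmat_succ_mulVec (g m : ℕ) (hm : m + 1 < g) (x : Fin g → ℤ) (k : Fin g) :
    (Tmat g (m + 1)).mulVec x k =
      if k.1 = m then x ⟨m + 1, hm⟩
      else if k.1 = m + 1 then 2 * x ⟨m + 1, hm⟩ - x ⟨m, by omega⟩
      else x k := by
  have single : ∀ (c : ℤ) (i : ℕ) (hi : i < g),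
      ∑ l : Fin g, (if l.1 = i then c else 0) * x l = c * x ⟨i, hi⟩ := by
    intro c i hi
    rw [Finset.sum_eq_single ⟨i, hi⟩]
    · simp
    · intro b _ hb
      rw [if_neg (fun h => hb (Fin.ext h)), zero_mul]
    · simp
  simp only [Matrix.mulVec, dotProduct, Tmat, Matrix.of_apply, add_left_inj]
  split_ifs with h1 h2
  · rw [single 1 (m + 1) hm, one_mul]
  · have split_entry : ∀ l : Fin g,
        (if l.1 = m then (-1 : ℤ) else if l.1 = m + 1 then 2 else 0) * x l =
          (if l.1 = m then -1 else 0) * x l + (if l.1 = m + 1 then 2 else 0) * x l := by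
      intro l
      split_ifs <;> omega
    simp only [split_entry]
    rw [Finset.sum_add_distrib, single (-1) m (by omega), single 2 (m + 1) hm]
    ring
  · simp

theorem Tmat_mulVec_onesVec (g j : ℕ) (h1 : 1 ≤ j) (h2 : j ≤ g - 1) :
    (Tmat g j).mulVec (onesVec g) = onesVec g := by
  obtain ⟨m, rfl⟩ : ∃ m, j = m + 1 := ⟨j - 1, by omega⟩
  funext k
  rw [Tmat_succ_mulVec g m (by omega)]
  simp [onesVec]

theorem exists_TbCompat (g : ℕ) : ∃ Tb : ℕ → Module.End ℤ (Mg g), TbCompat g Tb := by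
  have le_comap : ∀ j, 1 ≤ j ∧ j ≤ g - 1 →
      relSub g ≤ (relSub g).comap (Tmat g j).mulVecLin := by
    rintro j ⟨h1, h2⟩
    rw [relSub, Submodule.span_le, Set.singleton_subset_iff]
    rw [SetLike.mem_coe, Submodule.mem_comap, map_smul, Matrix.mulVecLin_apply,
      Tmat_mulVec_onesVec g j h1 h2]
    exact Submodule.mem_span_singleton_self _
  classical
  refine ⟨fun j => if h : 1 ≤ j ∧ j ≤ g - 1 then
    (relSub g).mapQ (relSub g) (Tmat g j).mulVecLin (le_comap j h) else 0, ?_⟩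
  intro j h1 h2 x
  simp only [dif_pos (And.intro h1 h2)]
  rfl

/-- The action of the partial product `T̄_1 ⋯ T̄_m` on coordinates. -/
theorem TbCompat.prod_range_mk {g : ℕ} {Tb : ℕ → Module.End ℤ (Mg g)} (h : TbCompat g Tb)
    (m : ℕ) (hm : m < g) (x : Fin g → ℤ) :
    (((List.range m).map fun i => Tb (i + 1)).prod) (Submodule.Quotient.mk x) =
      Submodule.Quotient.mk (fun k : Fin g =>
        if k.1 = 0 then x ⟨m, hm⟩
        else if k.1 ≤ m then 2 * x ⟨m, hm⟩ - x ⟨k.1 - 1, by omega⟩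
        else x k) := by
  induction m generalizing x with
  | zero =>
    simp only [List.range_zero, List.map_nil, List.prod_nil, Module.End.one_apply]
    congr 1
    funext k
    split_ifs with h1 h2
    · exact congrArg x (Fin.ext h1)
    · omega
    · rfl
  | succ m ih =>
    rw [List.range_succ, List.map_append, List.prod_append, List.map_singleton,
      List.prod_singleton, Module.End.mul_apply, h (m + 1) (by omega) (by omega),
      ih (by omega)]
    congr 1
    funext k
    simp only [Tmat_succ_mulVec g m hm]
    rcases Nat.lt_trichotomy k.1 (m + 1) with hk | hk | hk
    · by_cases h0 : k.1 = 0
      · simp [h0]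
      · simp [h0, show k.1 ≤ m by omega, show k.1 ≤ m + 1 by omega,
          show k.1 - 1 ≠ m by omega, show k.1 - 1 ≠ m + 1 by omega]
    · simp [hk]
    · simp [show k.1 ≠ 0 by omega, show ¬ k.1 ≤ m by omega, show ¬ k.1 ≤ m + 1 by omega,
        show k.1 ≠ m by omega, show k.1 ≠ m + 1 by omega]

/-- On `M_g` the product `T̄_1 ⋯ T̄_{g-1}` is minus the cyclic shift of coordinates. -/
theorem TbCompat.prod_mk {g : ℕ} [NeZero g] (hg : 2 ≤ g) {Tb : ℕ → Module.End ℤ (Mg g)}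
    (h : TbCompat g Tb) (x : Fin g → ℤ) :
    (((List.range (g - 1)).map fun i => Tb (i + 1)).prod) (Submodule.Quotient.mk x) =
      Submodule.Quotient.mk (fun k : Fin g => -x (k - 1)) := by
  rw [h.prod_range_mk (g - 1) (by omega), Submodule.Quotient.eq, relSub,
    Submodule.mem_span_singleton]
  refine ⟨x ⟨g - 1, by omega⟩, ?_⟩
  funext k
  have one_val : (1 : Fin g).1 = 1 := by
    rw [Fin.val_one', Nat.mod_eq_of_lt (by omega)]
  have sub_val : (k - 1).1 = if k.1 = 0 then g - 1 else k.1 - 1 := by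
    rw [Fin.val_sub, one_val]
    split_ifs with h0
    · rw [h0, add_zero, Nat.mod_eq_of_lt (by omega)]
    · rw [show g - 1 + k.1 = (k.1 - 1) + g by omega, Nat.add_mod_right,
        Nat.mod_eq_of_lt (by omega)]
  simp only [onesVec, Pi.smul_apply, Pi.sub_apply, smul_eq_mul]
  by_cases h0 : k.1 = 0
  · have hk : k - 1 = ⟨g - 1, by omega⟩ := Fin.ext (by rw [sub_val, if_pos h0])
    rw [if_pos h0, hk]
    ring
  · have hk : k - 1 = ⟨k.1 - 1, by omega⟩ := Fin.ext (by rw [sub_val, if_neg h0])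
    rw [if_neg h0, if_pos (by omega), hk]
    ring

theorem TbCompat.prod_pow_mk {g : ℕ} [NeZero g] (hg : 2 ≤ g) {Tb : ℕ → Module.End ℤ (Mg g)}
    (h : TbCompat g Tb) (n : ℕ) (x : Fin g → ℤ) :
    ((((List.range (g - 1)).map fun i => Tb (i + 1)).prod) ^ n) (Submodule.Quotient.mk x) =
      Submodule.Quotient.mk (fun k : Fin g => (-1) ^ n * x (k - n • 1)) := by
  induction n with
  | zero => simp
  | succ n ih =>
    rw [pow_succ', Module.End.mul_apply, ih, h.prod_mk hg]
    congr 1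
    funext k
    rw [sub_sub, ← succ_nsmul', pow_succ]
    ring

/-- Each matrix `T_j` fixes `γ_1+⋯+γ_g`, hence induces an automorphism `T̄_j` of
`M_g = ℤ^g/⟨2(γ_1+⋯+γ_g)⟩`, and `(T̄_1 T̄_2 ⋯ T̄_{g-1})^g` is the identity if `g` is even
and `-id` if `g` is odd (the image of relation (B3) of the Paris–Szepietowski
presentation). -/
theorem twist_product_power (g : ℕ) (hg : 4 ≤ g) :
    (∀ j, 1 ≤ j → j ≤ g - 1 → (Tmat g j).mulVec (onesVec g) = onesVec g) ∧
    (∃ Tb : ℕ → Module.End ℤ (Mg g), TbCompat g Tb) ∧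
    (∀ Tb : ℕ → Module.End ℤ (Mg g), TbCompat g Tb →
      (Even g → (((List.range (g - 1)).map fun i => Tb (i + 1)).prod) ^ g = 1) ∧
      (Odd g → (((List.range (g - 1)).map fun i => Tb (i + 1)).prod) ^ g = -1)) := by
  have : NeZero g := ⟨by omega⟩
  refine ⟨Tmat_mulVec_onesVec g, exists_TbCompat g, fun Tb h => ?_⟩
  have pow_card : ∀ x : Fin g → ℤ,
      ((((List.range (g - 1)).map fun i => Tb (i + 1)).prod) ^ g) (Submodule.Quotient.mk x) =
        Submodule.Quotient.mk (fun k : Fin g => (-1) ^ g * x k) := by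
    intro x
    have order : g • (1 : Fin g) = 0 := by
      simpa using card_nsmul_eq_zero' (x := (1 : Fin g))
    rw [h.prod_pow_mk (by omega), order]
    simp only [sub_zero]
  constructor
  · intro he
    refine LinearMap.ext fun y => ?_
    obtain ⟨x, rfl⟩ := Submodule.Quotient.mk_surjective _ y
    rw [pow_card, he.neg_one_pow]
    simp
  · intro ho
    refine LinearMap.ext fun y => ?_
    obtain ⟨x, rfl⟩ := Submodule.Quotient.mk_surjective _ y
    rw [pow_card, ho.neg_one_pow, LinearMap.neg_apply, Module.End.one_apply,
      ← Submodule.Quotient.mk_neg]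
    congr 1
    funext k
    simp
end

section
/- Let g ≥ 4. Each of the matrices U_1, T_1, …, T_{g−1} and −I fixes the subgroup ⟨2(γ_1+⋯+γ_g)⟩ of ℤ^g, hence induces an automorphism of the quotient group M_g = ℤ^g/⟨2(γ_1+⋯+γ_g)⟩. Let W be the automorphism of M_g induced by the composite U_1 ∘ T_1 ∘ T_2 ∘ ⋯ ∘ T_{g−1} ∘ (−I). Then W^{g−1} is the identity automorphism of M_g. -/
/-- The matrix of `u_1 ∘ a_1 ∘ a_2 ∘ ⋯ ∘ a_{g-1} ∘ ρ` acting on `ℤ^g`. -/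
def Cmat (g : ℕ) : Matrix (Fin g) (Fin g) ℤ :=
  Umat g 1 * (((List.range (g - 1)).map fun i => Tmat g (i + 1)).prod) * (-1)

/-- `W` is the endomorphism of `M_g` induced by `U_1 ∘ T_1 ∘ ⋯ ∘ T_{g-1} ∘ (-I)`. -/
def WCompat (g : ℕ) (W : Module.End ℤ (Mg g)) : Prop :=
  ∀ x : Fin g → ℤ,
    W (Submodule.Quotient.mk x) = Submodule.Quotient.mk ((Cmat g).mulVec x)

open Matrix

theorem Tmat_mulVec (g j : ℕ) (h : j + 1 < g) (x : Fin g → ℤ) (k : Fin g) :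
    (Tmat g (j + 1) *ᵥ x) k =
      if k.1 = j then x ⟨j + 1, h⟩
      else if k.1 = j + 1 then 2 * x ⟨j + 1, h⟩ - x ⟨j, by omega⟩
      else x k := by
  have e1 (l : Fin g) : l.1 = j + 1 ↔ l = ⟨j + 1, h⟩ := by simp [Fin.ext_iff]
  have e0 (l : Fin g) : l.1 = j ↔ l = ⟨j, by omega⟩ := by simp [Fin.ext_iff]
  simp only [mulVec, dotProduct, Tmat, Matrix.of_apply, Nat.add_right_cancel_iff]
  split_ifs with h0 h1
  · simp [e1]
  · trans ∑ l : Fin g, ((if l.1 = j + 1 then 2 * x l else 0) - (if l.1 = j then x l else 0))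
    · refine Finset.sum_congr rfl fun l _ => ?_
      split_ifs <;> omega
    simp only [Finset.sum_sub_distrib, e0, e1]
    simp
  · simp

theorem Umat_one_mulVec (g : ℕ) (h : 1 < g) (x : Fin g → ℤ) (k : Fin g) :
    (Umat g 1 *ᵥ x) k =
      if k.1 = 0 then x ⟨1, h⟩ else if k.1 = 1 then x ⟨0, by omega⟩ else x k := by
  have e1 (l : Fin g) : l.1 = 1 ↔ l = ⟨1, h⟩ := by simp [Fin.ext_iff]
  have e0 (l : Fin g) : l.1 = 0 ↔ l = ⟨0, by omega⟩ := by simp [Fin.ext_iff]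
  simp only [mulVec, dotProduct, Umat, Matrix.of_apply, Nat.add_right_cancel_iff,
    Nat.add_eq_right]
  split_ifs with h0 h1
  · simp [e1]
  · simp [e0]
  · simp

theorem prod_Tmat_mulVec (g n : ℕ) (h : n < g) (x : Fin g → ℤ) (k : Fin g) :
    (((List.range n).map fun i => Tmat g (i + 1)).prod *ᵥ x) k =
      if k.1 = 0 then x ⟨n, h⟩
      else if k.1 ≤ n then 2 * x ⟨n, h⟩ - x ⟨k.1 - 1, by omega⟩
      else x k := by
  induction n generalizing x with
  | zero =>
    simp only [List.range_zero, List.map_nil, List.prod_nil, one_mulVec]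
    split_ifs with h0 h1
    · congr 1; exact Fin.ext h0
    · omega
    · rfl
  | succ n ih =>
    rw [List.range_succ, List.map_append, List.prod_append, List.map_singleton,
      List.prod_singleton, ← mulVec_mulVec, ih (by omega)]
    simp only [Tmat_mulVec g n h]
    by_cases h0 : k.1 = 0
    · simp [h0]
    by_cases h1 : k.1 ≤ n
    · have a : k.1 - 1 ≠ n := by omega
      have b : k.1 - 1 ≠ n + 1 := by omega
      have c : k.1 ≤ n + 1 := by omega
      simp [h0, h1, a, b, c]
    by_cases h2 : k.1 = n + 1
    · simp [h2]
    · have a : ¬ k.1 ≤ n + 1 := by omega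
      have b : k.1 ≠ n := by omega
      simp [h0, h1, h2, a, b]

/-- Fix the first coordinate and shift the remaining ones cyclically by `a`. -/
def tailShift {m : ℕ} [NeZero m] (a : Fin m) (x : Fin (m + 1) → ℤ) : Fin (m + 1) → ℤ :=
  Fin.cons (x 0) fun k => x (k - a).succ

theorem tailShift_zero {m : ℕ} [NeZero m] (x : Fin (m + 1) → ℤ) : tailShift 0 x = x := by
  ext k
  cases k using Fin.cases <;> simp [tailShift]

theorem tailShift_tailShift {m : ℕ} [NeZero m] (a b : Fin m) (x : Fin (m + 1) → ℤ) :
    tailShift a (tailShift b x) = tailShift (a + b) x := by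
  ext k
  cases k using Fin.cases <;> simp [tailShift, sub_sub]

theorem Cmat_mulVec {m : ℕ} [NeZero m] (x : Fin (m + 1) → ℤ) :
    Cmat (m + 1) *ᵥ x = tailShift 1 x - x (Fin.last m) • (2 : ℤ) • onesVec (m + 1) := by
  have hm : 0 < m := Nat.pos_of_neZero m
  ext k
  simp only [Cmat, ← mulVec_mulVec, neg_mulVec, one_mulVec, Nat.add_sub_cancel]
  rw [Umat_one_mulVec _ (by omega)]
  simp only [prod_Tmat_mulVec (m + 1) m (by omega)]
  cases k using Fin.cases with
  | zero =>
    have : 1 ≤ m := hm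
    simp [tailShift, onesVec, this, Fin.last]
    ring
  | succ k =>
    have hk := k.isLt
    by_cases h0 : k.1 = 0
    · have hl : (k - 1).succ = Fin.last m := by
        obtain ⟨n, rfl⟩ := Nat.exists_eq_succ_of_ne_zero hm.ne'
        obtain rfl : k = 0 := Fin.ext h0
        simp [Fin.ext_iff]
      simp only [tailShift, onesVec, Fin.cons_succ, hl, Pi.sub_apply, Pi.smul_apply]
      simp [h0, Fin.last]
      ring
    · have hl : (k - 1).succ = ⟨k.1, by omega⟩ := by
        have hk0 : k ≠ 0 := fun e => h0 (by simp [e])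
        obtain ⟨n, rfl⟩ := Nat.exists_eq_succ_of_ne_zero hm.ne'
        simp only [Fin.ext_iff, Fin.val_succ, Fin.val_sub_one_of_ne_zero hk0]
        omega
      have hle : k.1 + 1 ≤ m := hk
      simp only [tailShift, onesVec, Fin.cons_succ, hl, Pi.sub_apply, Pi.smul_apply]
      simp [h0, hle, Fin.last]
      ring

theorem mulVec_mem_relSub {g : ℕ} {A : Matrix (Fin g) (Fin g) ℤ}
    (hA : A *ᵥ onesVec g ∈ Submodule.span ℤ {onesVec g}) {x : Fin g → ℤ} (hx : x ∈ relSub g) :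
    A *ᵥ x ∈ relSub g := by
  obtain ⟨c, rfl⟩ := Submodule.mem_span_singleton.1 hx
  obtain ⟨d, hd⟩ := Submodule.mem_span_singleton.1 hA
  refine Submodule.mem_span_singleton.2 ⟨c * d, ?_⟩
  rw [mulVec_smul, mulVec_smul, ← hd]
  module

theorem Tmat_mulVec_mem_relSub {g j : ℕ} (h1 : 1 ≤ j) (hj : j ≤ g - 1) {x : Fin g → ℤ}
    (hx : x ∈ relSub g) : Tmat g j *ᵥ x ∈ relSub g := by
  obtain ⟨i, rfl⟩ := Nat.exists_eq_add_of_le' h1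
  refine mulVec_mem_relSub (Submodule.mem_span_singleton.2 ⟨1, ?_⟩) hx
  ext k
  rw [Tmat_mulVec _ _ (by omega)]
  simp [onesVec]

theorem Umat_one_mulVec_mem_relSub {g : ℕ} (hg : 1 < g) {x : Fin g → ℤ}
    (hx : x ∈ relSub g) : Umat g 1 *ᵥ x ∈ relSub g := by
  refine mulVec_mem_relSub (Submodule.mem_span_singleton.2 ⟨1, ?_⟩) hx
  ext k
  rw [Umat_one_mulVec _ hg]
  simp [onesVec]

theorem Cmat_mulVec_mem_relSub {m : ℕ} [NeZero m] {x : Fin (m + 1) → ℤ}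
    (hx : x ∈ relSub (m + 1)) : Cmat (m + 1) *ᵥ x ∈ relSub (m + 1) := by
  refine mulVec_mem_relSub (Submodule.mem_span_singleton.2 ⟨-1, ?_⟩) hx
  rw [Cmat_mulVec]
  ext k
  cases k using Fin.cases <;> simp [tailShift, onesVec]

theorem WCompat.apply_mk {m : ℕ} [NeZero m] {W : Module.End ℤ (Mg (m + 1))}
    (hW : WCompat (m + 1) W) (x : Fin (m + 1) → ℤ) :
    W (Submodule.Quotient.mk x) = Submodule.Quotient.mk (tailShift 1 x) := by
  rw [hW, Cmat_mulVec, Submodule.Quotient.eq, sub_sub_cancel_left]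
  exact neg_mem (Submodule.smul_mem _ _ (Submodule.mem_span_singleton_self _))

theorem WCompat.pow_apply_mk {m : ℕ} [NeZero m] {W : Module.End ℤ (Mg (m + 1))}
    (hW : WCompat (m + 1) W) (n : ℕ) (x : Fin (m + 1) → ℤ) :
    (W ^ n) (Submodule.Quotient.mk x) = Submodule.Quotient.mk (tailShift (n • 1) x) := by
  induction n with
  | zero => simp [tailShift_zero]
  | succ n ih =>
    rw [pow_succ', Module.End.mul_apply, ih, hW.apply_mk, tailShift_tailShift, succ_nsmul']

/-- Each of `U_1`, `T_1, …, T_{g-1}` and `-I` fixes the subgroup `⟨2(γ_1+⋯+γ_g)⟩` of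
`ℤ^g`, hence induces an automorphism of `M_g = ℤ^g/⟨2(γ_1+⋯+γ_g)⟩`; the automorphism `W`
of `M_g` induced by `U_1 ∘ T_1 ∘ ⋯ ∘ T_{g-1} ∘ (-I)` satisfies `W^{g-1} = 1` (the image of
relation (F) of the Paris–Szepietowski presentation). -/
theorem relation_F_power (g : ℕ) (hg : 4 ≤ g) :
    (∀ j, 1 ≤ j → j ≤ g - 1 → ∀ x ∈ relSub g, (Tmat g j).mulVec x ∈ relSub g) ∧
    (∀ x ∈ relSub g, (Umat g 1).mulVec x ∈ relSub g) ∧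
    (∀ x ∈ relSub g, (-1 : Matrix (Fin g) (Fin g) ℤ).mulVec x ∈ relSub g) ∧
    (∃ W : Module.End ℤ (Mg g), WCompat g W) ∧
    (∀ W : Module.End ℤ (Mg g), WCompat g W → W ^ (g - 1) = 1) := by
  obtain ⟨m, rfl⟩ : ∃ m, g = m + 1 := ⟨g - 1, by omega⟩
  have : NeZero m := ⟨by omega⟩
  refine ⟨fun j h1 hj x hx => Tmat_mulVec_mem_relSub h1 hj hx,
    fun x hx => Umat_one_mulVec_mem_relSub (by omega) hx,
    fun x hx => by simpa [neg_mulVec] using hx,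
    ⟨(relSub (m + 1)).mapQ (relSub (m + 1)) (Cmat (m + 1)).mulVecLin
      fun x hx => Cmat_mulVec_mem_relSub hx, fun x => rfl⟩, fun W hW => ?_⟩
  refine LinearMap.ext fun y => ?_
  obtain ⟨x, rfl⟩ := Submodule.Quotient.mk_surjective _ y
  have hm : m • (1 : Fin m) = 0 := by
    simpa using card_nsmul_eq_zero' (x := (1 : Fin m))
  simpa [hm, tailShift_zero] using hW.pow_apply_mk m x
end
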